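/- Let X be a complex Hilbert space and T a C₀-semigroup on X with ‖T(t)‖ ≤ M₀ e^{ω₀ t}. Let R : {λ ∈ ℂ : Re λ > 0} → L(X) satisfy the resolvent identity on {Re λ > 0} and the Laplace-transform identity R(λ)x = ∫₀^∞ e^{−λt} T(t)x dt for Re λ > max(ω₀, 0). Suppose g : (0,∞) → (0,∞) is non-decreasing with ‖R(λ)‖ ≤ g(1/Re λ) for all λ with Re λ > 0. Then there exists C ≥ 0 such that ‖T(t)‖ ≤ C g(t) for all t ≥ 1. (In particular, the Kreiss condition ‖R(λ,A)‖ ≤ C₀/Re λ on a Hilbert space implies at most linear growth of the semigroup.) -/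

import Mathlib

open MeasureTheory

open FourierTransform in
theorem lintegral_enorm_fourier_sq {X : Type*} [NormedAddCommGroup X] [InnerProductSpace ℂ X]
    [CompleteSpace X] {f : ℝ → X} (hf : Integrable f) (hf2 : MemLp f 2) :
    ∫⁻ ξ, ‖𝓕 f ξ‖ₑ ^ 2 = ∫⁻ t, ‖f t‖ₑ ^ 2 := by
  have hcont : Continuous (𝓕 f) :=
    VectorFourier.fourierIntegral_continuous Real.continuous_fourierChar
      (innerSL ℝ).continuous₂ hf
  have hae : ∀ᵐ ξ, (𝓕 hf2.toLp : Lp X 2 (volume : Measure ℝ)) ξ = 𝓕 f ξ := by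
    refine ae_eq_of_integral_contDiff_smul_eq
      ((Lp.memLp _).locallyIntegrable (by norm_num)) hcont.locallyIntegrable fun g hg hg' => ?_
    have hg₁ : HasCompactSupport (Complex.ofRealCLM ∘ g) := hg'.comp_left rfl
    have hg₂ : ContDiff ℝ (⊤ : ℕ∞) (Complex.ofRealCLM ∘ g) := by fun_prop
    have h1 := congrArg (fun d => d (hg₁.toSchwartzMap hg₂))
      (Lp.fourier_toTemperedDistribution_eq (hf2.toLp : Lp X 2 (volume : Measure ℝ)))
    simp only [TemperedDistribution.fourier_apply, Lp.toTemperedDistribution_apply] at h1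
    have h2 := VectorFourier.integral_fourierIntegral_smul_eq_flip (L := innerₗ ℝ)
      Real.continuous_fourierChar continuous_inner
      (SchwartzMap.integrable (μ := volume) (hg₁.toSchwartzMap hg₂)) hf
    calc ∫ x, g x • (𝓕 hf2.toLp : Lp X 2 (volume : Measure ℝ)) x
        = ∫ x, (hg₁.toSchwartzMap hg₂) x • (𝓕 hf2.toLp : Lp X 2 (volume : Measure ℝ)) x := by
          simp
      _ = ∫ x, 𝓕 (hg₁.toSchwartzMap hg₂) x • (hf2.toLp : Lp X 2 (volume : Measure ℝ)) x := h1.symm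
      _ = ∫ x, 𝓕 (hg₁.toSchwartzMap hg₂) x • f x := by
          refine integral_congr_ae ?_
          filter_upwards [hf2.coeFn_toLp] with x hx
          rw [hx]
      _ = ∫ x, (hg₁.toSchwartzMap hg₂) x • 𝓕 f x := by
          simpa [SchwartzMap.fourier_coe] using! h2
      _ = _ := by simp
  have hn := Lp.norm_fourier_eq (hf2.toLp : Lp X 2 (volume : Measure ℝ))
  have he : eLpNorm (𝓕 f) 2 volume = eLpNorm f 2 volume := by
    rw [← eLpNorm_congr_ae hae, ← eLpNorm_congr_ae hf2.coeFn_toLp, ← Lp.enorm_def, ← Lp.enorm_def,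
      ← ofReal_norm, ← ofReal_norm, hn]
  simpa using
    (show (∫⁻ ξ, ‖𝓕 f ξ‖ₑ ^ ((2 : NNReal) : ℝ)) = ∫⁻ t, ‖f t‖ₑ ^ ((2 : NNReal) : ℝ) by
      rw [← eLpNorm_nnreal_pow_eq_lintegral two_ne_zero,
        ← eLpNorm_nnreal_pow_eq_lintegral two_ne_zero]
      exact congrArg (· ^ _) he)

theorem differentiableOn_of_resolvent_identity {X : Type*} [NormedAddCommGroup X] [NormedSpace ℂ X]
    {R : ℂ → (X →L[ℂ] X)} {U : Set ℂ} (hU : IsOpen U)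
    (hres : ∀ l ∈ U, ∀ μ ∈ U, R l - R μ = (μ - l) • ((R l).comp (R μ)))
    (hbdd : ∀ μ ∈ U, ∃ C : ℝ, ∀ᶠ l in nhds μ, ‖R l‖ ≤ C) :
    DifferentiableOn ℂ R U := by
  intro μ hμ
  obtain ⟨C, hC⟩ := hbdd μ hμ
  have hcont : Filter.Tendsto R (nhds μ) (nhds (R μ)) := by
    rw [tendsto_iff_norm_sub_tendsto_zero]
    have h0 : Filter.Tendsto (fun l => ‖μ - l‖ * (C * ‖R μ‖)) (nhds μ) (nhds 0) := by
      have : Continuous fun l : ℂ => ‖μ - l‖ * (C * ‖R μ‖) := by fun_prop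
      simpa using this.tendsto μ
    refine squeeze_zero' (.of_forall fun _ => norm_nonneg _) ?_ h0
    filter_upwards [hC, hU.mem_nhds hμ] with l hl hlU
    rw [hres l hlU μ hμ, norm_smul]
    gcongr
    exact (ContinuousLinearMap.opNorm_comp_le _ _).trans (by gcongr)
  have hder : HasDerivAt R (-(R μ).comp (R μ)) μ := by
    rw [hasDerivAt_iff_tendsto_slope]
    have h1 : Filter.Tendsto (fun l => -(R l).comp (R μ)) (nhdsWithin μ {μ}ᶜ)
        (nhds (-(R μ).comp (R μ))) :=
      (((by fun_prop : Continuous fun S : X →L[ℂ] X => -S.comp (R μ)).tendsto (R μ)).comp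
        (hcont.mono_left nhdsWithin_le_nhds))
    refine h1.congr' ?_
    filter_upwards [nhdsWithin_le_nhds (hU.mem_nhds hμ), self_mem_nhdsWithin] with l hlU hl
    have : l - μ ≠ 0 := sub_ne_zero.2 hl
    rw [slope_def_module, hres l hlU μ hμ, smul_smul, ← neg_sub l μ, mul_neg,
      inv_mul_cancel₀ this, neg_one_smul]
  exact hder.differentiableAt.differentiableWithinAt

theorem differentiable_intervalIntegral_exp_smul {X : Type*} [NormedAddCommGroup X]
    [NormedSpace ℂ X] [CompleteSpace X] {u : ℝ → X} {τ : ℝ} (hτ : 0 ≤ τ)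
    (hu : ContinuousOn u (Set.Icc 0 τ)) :
    Differentiable ℂ fun l : ℂ => ∫ t in (0:ℝ)..τ, Complex.exp (-(l * t)) • u t := by
  intro μ
  obtain ⟨K, hK⟩ := isCompact_Icc.exists_bound_of_continuousOn hu
  have hsub : Set.uIoc 0 τ ⊆ Set.Icc 0 τ := by
    rw [Set.uIoc_of_le hτ]; exact Set.Ioc_subset_Icc_self
  have hc : ∀ l : ℂ, ContinuousOn (fun t : ℝ => Complex.exp (-(l * t)) • u t) (Set.Icc 0 τ) :=
    fun l => (by fun_prop : Continuous fun t : ℝ => Complex.exp (-(l * t))).continuousOn.smul hu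
  have hc' : ContinuousOn (fun t : ℝ => (-(t : ℂ) * Complex.exp (-(μ * t))) • u t)
      (Set.Icc 0 τ) :=
    (by fun_prop : Continuous fun t : ℝ =>
      -(t : ℂ) * Complex.exp (-(μ * t))).continuousOn.smul hu
  refine (intervalIntegral.hasDerivAt_integral_of_dominated_loc_of_deriv_le
    (F' := fun (l : ℂ) (t : ℝ) => (-(t : ℂ) * Complex.exp (-(l * t))) • u t)
    (bound := fun _ => τ * Real.exp ((‖μ‖ + 1) * τ) * K)
    (Metric.ball_mem_nhds μ one_pos) ?_ ?_ ?_ ?_ ?_ ?_).2.differentiableAt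
  · exact .of_forall fun l => ((hc l).mono hsub).aestronglyMeasurable measurableSet_uIoc
  · exact (hc μ).intervalIntegrable_of_Icc hτ
  · exact (hc'.mono hsub).aestronglyMeasurable measurableSet_uIoc
  · refine .of_forall fun t ht l hl => ?_
    have ht' := hsub ht
    have hl' : ‖l‖ ≤ ‖μ‖ + 1 := by
      have := norm_sub_norm_le l μ
      rw [Metric.mem_ball, dist_eq_norm] at hl
      linarith
    rw [norm_smul, norm_mul, norm_neg, Complex.norm_real, Real.norm_of_nonneg ht'.1]
    have hexp : ‖Complex.exp (-(l * t))‖ ≤ Real.exp ((‖μ‖ + 1) * τ) := by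
      refine (Complex.norm_exp_le_exp_norm _).trans (Real.exp_le_exp.2 ?_)
      rw [norm_neg, norm_mul, Complex.norm_real, Real.norm_of_nonneg ht'.1]
      exact mul_le_mul hl' ht'.2 ht'.1 (by positivity)
    exact mul_le_mul (mul_le_mul ht'.2 hexp (norm_nonneg _) hτ) (hK t ht') (norm_nonneg _)
      (by positivity)
  · exact intervalIntegrable_const
  · refine .of_forall fun t _ l _ => ?_
    have h : HasDerivAt (fun l : ℂ => Complex.exp (-(l * t)))
        (-(t : ℂ) * Complex.exp (-(l * t))) l := by
      simpa [mul_comm] using (((hasDerivAt_id l).mul_const (t : ℂ)).neg).cexp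
    exact h.smul_const _

theorem norm_exp_neg_mul_ofReal (l : ℂ) (t : ℝ) :
    ‖Complex.exp (-(l * t))‖ = Real.exp (-(l.re * t)) := by
  simp [Complex.norm_exp]

theorem integrableOn_exp_smul_of_bound {X : Type*} [NormedAddCommGroup X] [NormedSpace ℂ X]
    {u : ℝ → X} {K ω₀ : ℝ} (hu : ContinuousOn u (Set.Ici 0))
    (hbdd : ∀ t : ℝ, 0 ≤ t → ‖u t‖ ≤ K * Real.exp (ω₀ * t)) {l : ℂ} (hl : ω₀ < l.re) :
    IntegrableOn (fun t : ℝ => Complex.exp (-(l * t)) • u t) (Set.Ioi 0) := by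
  have hc : ContinuousOn (fun t : ℝ => Complex.exp (-(l * t)) • u t) (Set.Ioi 0) :=
    (by fun_prop : Continuous fun t : ℝ => Complex.exp (-(l * t))).continuousOn.smul
      (hu.mono Set.Ioi_subset_Ici_self)
  refine Integrable.mono' ((exp_neg_integrableOn_Ioi 0 (sub_pos.2 hl)).const_mul K)
    (hc.aestronglyMeasurable measurableSet_Ioi) ?_
  filter_upwards [ae_restrict_mem measurableSet_Ioi] with t ht
  rw [norm_smul, norm_exp_neg_mul_ofReal]
  calc Real.exp (-(l.re * t)) * ‖u t‖
      ≤ Real.exp (-(l.re * t)) * (K * Real.exp (ω₀ * t)) := by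
        gcongr
        exact hbdd t (le_of_lt ht)
    _ = K * (Real.exp (-(l.re * t)) * Real.exp (ω₀ * t)) := by ring
    _ = K * Real.exp (-(l.re - ω₀) * t) := by
        rw [← Real.exp_add]
        ring_nf

theorem setIntegral_Ioi_eq_comp_add {X : Type*} [NormedAddCommGroup X] [NormedSpace ℝ X]
    (f : ℝ → X) (τ : ℝ) :
    ∫ t in Set.Ioi τ, f t = ∫ t in Set.Ioi 0, f (t + τ) := by
  have := (measurePreserving_add_right (volume : Measure ℝ) τ).setIntegral_preimage_emb
    (measurableEmbedding_addRight τ) f (Set.Ioi τ)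
  simpa using this.symm

theorem integral_exp_smul_semigroup_eq_resolvent
    {X : Type*} [NormedAddCommGroup X] [NormedSpace ℂ X] [CompleteSpace X]
    {T : ℝ → (X →L[ℂ] X)} {M₀ ω₀ : ℝ}
    (hTsemi : ∀ s t : ℝ, 0 ≤ s → 0 ≤ t → T (s + t) = (T s).comp (T t))
    (hTcont : ∀ x : X, ContinuousOn (fun t => T t x) (Set.Ici 0))
    (hTbdd : ∀ t : ℝ, 0 ≤ t → ‖T t‖ ≤ M₀ * Real.exp (ω₀ * t))
    {R : ℂ → (X →L[ℂ] X)} (hR : DifferentiableOn ℂ R {l | 0 < l.re})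
    (hlap : ∀ l : ℂ, max ω₀ 0 < l.re → ∀ x : X,
      R l x = ∫ t in Set.Ioi (0:ℝ), Complex.exp (-(l * t)) • T t x)
    {τ : ℝ} (hτ : 0 ≤ τ) (x : X) {l : ℂ} (hl : 0 < l.re) :
    ∫ t in (0:ℝ)..τ, Complex.exp (-(l * t)) • T t x =
      R l (x - Complex.exp (-(l * τ)) • T τ x) := by
  have hopen : ∀ r : ℝ, IsOpen {l : ℂ | r < l.re} :=
    fun r => isOpen_lt continuous_const Complex.continuous_re
  have hright : DifferentiableOn ℂ (fun l => R l (x - Complex.exp (-(l * τ)) • T τ x))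
      {l | 0 < l.re} :=
    hR.clm_apply (by fun_prop : Differentiable ℂ fun l : ℂ =>
      x - Complex.exp (-(l * τ)) • T τ x).differentiableOn
  have hleft := (differentiable_intervalIntegral_exp_smul (u := fun t => T t x) hτ
    ((hTcont x).mono Set.Icc_subset_Ici_self)).differentiableOn (s := {l : ℂ | 0 < l.re})
  have hz : max ω₀ 0 < ((max ω₀ 0 + 1 : ℝ) : ℂ).re := by simp
  refine (hleft.analyticOnNhd (hopen 0)).eqOn_of_preconnected_of_eventuallyEq
    (hright.analyticOnNhd (hopen 0)) (convex_halfSpace_re_gt 0).isPreconnected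
    (z₀ := ((max ω₀ 0 + 1 : ℝ) : ℂ)) (lt_of_le_of_lt (le_max_right _ _) hz) ?_ hl
  filter_upwards [(hopen (max ω₀ 0)).mem_nhds hz] with μ hμ
  have hu_int := integrableOn_exp_smul_of_bound (hTcont x) (K := M₀ * ‖x‖) (ω₀ := ω₀)
    (fun t ht => ((T t).le_of_opNorm_le (hTbdd t ht) x).trans_eq (by ring))
    (lt_of_le_of_lt (le_max_left _ _) hμ)
  have hsplit := intervalIntegral.integral_interval_add_Ioi hu_int
    (hu_int.mono_set (Set.Ioi_subset_Ioi hτ))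
  rw [eq_sub_of_add_eq hsplit, map_sub, map_smul, hlap μ hμ x, hlap μ hμ (T τ x),
    setIntegral_Ioi_eq_comp_add _ τ, ← integral_smul]
  congr 1
  refine setIntegral_congr_fun measurableSet_Ioi fun t ht => ?_
  rw [hTsemi t τ (le_of_lt ht) hτ, smul_smul, ← Complex.exp_add, ContinuousLinearMap.comp_apply]
  push_cast
  ring_nf

open FourierTransform in
theorem integral_norm_fourier_sq {X : Type*} [NormedAddCommGroup X] [InnerProductSpace ℂ X]
    [CompleteSpace X] {f : ℝ → X} (hf : Integrable f) (hf2 : MemLp f 2) :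
    Integrable (fun ξ => ‖𝓕 f ξ‖ ^ 2) ∧ ∫ ξ, ‖𝓕 f ξ‖ ^ 2 = ∫ t, ‖f t‖ ^ 2 := by
  have hcont : Continuous (𝓕 f) :=
    VectorFourier.fourierIntegral_continuous Real.continuous_fourierChar
      (innerSL ℝ).continuous₂ hf
  have henorm : ∀ v : X, ‖v‖ₑ ^ 2 = ENNReal.ofReal (‖v‖ ^ 2) := fun v => by
    rw [ENNReal.ofReal_pow (norm_nonneg _), ofReal_norm]
  have key := lintegral_enorm_fourier_sq hf hf2
  simp only [henorm] at key
  have hi := (memLp_two_iff_integrable_sq_norm hf2.1).1 hf2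
  have hi' : Integrable (fun ξ => ‖𝓕 f ξ‖ ^ 2) := by
    refine (lintegral_ofReal_ne_top_iff_integrable (by fun_prop)
      (.of_forall fun _ => sq_nonneg _)).1 ?_
    rw [key]
    exact (lintegral_ofReal_ne_top_iff_integrable hi.1 (.of_forall fun _ => sq_nonneg _)).2 hi
  refine ⟨hi', ?_⟩
  rw [integral_eq_lintegral_of_nonneg_ae (.of_forall fun _ => sq_nonneg _) hi'.1, key,
    ← integral_eq_lintegral_of_nonneg_ae (.of_forall fun _ => sq_nonneg _) hi.1]

/-- Plancherel's theorem for the Laplace transform restricted to a vertical line. -/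
theorem integral_norm_laplace_sq {X : Type*} [NormedAddCommGroup X] [InnerProductSpace ℂ X]
    [CompleteSpace X] {u : ℝ → X} {S : Set ℝ} (hS : MeasurableSet S) {a : ℝ}
    (hu : IntegrableOn (fun t : ℝ => Complex.exp (-((a : ℂ) * t)) • u t) S)
    (hu2 : IntegrableOn (fun t : ℝ => ‖Complex.exp (-((a : ℂ) * t)) • u t‖ ^ 2) S) :
    Integrable (fun ξ : ℝ => ‖∫ t in S, Complex.exp (-((a + (2 * Real.pi * ξ : ℝ) * Complex.I) * t))
      • u t‖ ^ 2) ∧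
    ∫ ξ : ℝ, ‖∫ t in S, Complex.exp (-((a + (2 * Real.pi * ξ : ℝ) * Complex.I) * t)) • u t‖ ^ 2 =
      ∫ t in S, ‖Complex.exp (-((a : ℂ) * t)) • u t‖ ^ 2 := by
  have hf : Integrable (S.indicator fun t : ℝ => Complex.exp (-((a : ℂ) * t)) • u t) :=
    (integrable_indicator_iff hS).2 hu
  have hf2 : MemLp (S.indicator fun t : ℝ => Complex.exp (-((a : ℂ) * t)) • u t) 2 :=
    (memLp_indicator_iff_restrict hS).2 ((memLp_two_iff_integrable_sq_norm hu.1).2 hu2)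
  have hfourier : ∀ ξ : ℝ,
      FourierTransform.fourier (S.indicator fun t : ℝ => Complex.exp (-((a : ℂ) * t)) • u t) ξ =
        ∫ t in S, Complex.exp (-((a + (2 * Real.pi * ξ : ℝ) * Complex.I) * t)) • u t := by
    intro ξ
    rw [Real.fourier_real_eq_integral_exp_smul, ← integral_indicator hS]
    congr 1 with t
    by_cases ht : t ∈ S
    · simp only [Set.indicator_of_mem ht, smul_smul, ← Complex.exp_add]
      push_cast
      ring_nf
    · simp [Set.indicator_of_notMem ht]
  have hsq : ∀ t : ℝ, ‖S.indicator (fun t : ℝ => Complex.exp (-((a : ℂ) * t)) • u t) t‖ ^ 2 =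
      S.indicator (fun t : ℝ => ‖Complex.exp (-((a : ℂ) * t)) • u t‖ ^ 2) t := by
    intro t
    by_cases ht : t ∈ S <;> simp [ht]
  have := integral_norm_fourier_sq hf hf2
  simpa only [hfourier, hsq, integral_indicator hS] using this

theorem integral_norm_resolvent_sq_le
    {X : Type*} [NormedAddCommGroup X] [InnerProductSpace ℂ X] [CompleteSpace X]
    {T : ℝ → (X →L[ℂ] X)} {M₀ ω₀ : ℝ}
    (hTcont : ∀ x : X, ContinuousOn (fun t => T t x) (Set.Ici 0))
    (hTbdd : ∀ t : ℝ, 0 ≤ t → ‖T t‖ ≤ M₀ * Real.exp (ω₀ * t))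
    {R : ℂ → (X →L[ℂ] X)}
    (hlap : ∀ l : ℂ, max ω₀ 0 < l.re → ∀ x : X,
      R l x = ∫ t in Set.Ioi (0:ℝ), Complex.exp (-(l * t)) • T t x)
    {ω : ℝ} (hω : max ω₀ 0 + 1 ≤ ω) (x : X) :
    Integrable (fun ξ : ℝ => ‖R (ω + (2 * Real.pi * ξ : ℝ) * Complex.I) x‖ ^ 2) ∧
    ∫ ξ : ℝ, ‖R (ω + (2 * Real.pi * ξ : ℝ) * Complex.I) x‖ ^ 2 ≤ M₀ ^ 2 * ‖x‖ ^ 2 := by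
  have hω₀ : ω₀ + 1 ≤ ω := (add_le_add_left (le_max_left _ _) _).trans hω
  have hbd : ∀ t : ℝ, 0 ≤ t → ‖T t x‖ ≤ M₀ * ‖x‖ * Real.exp (ω₀ * t) := fun t ht =>
    ((T t).le_of_opNorm_le (hTbdd t ht) x).trans_eq (by ring)
  have hu_int := integrableOn_exp_smul_of_bound (hTcont x) hbd (l := (ω : ℂ))
    (by simp only [Complex.ofReal_re]; linarith)
  have hsq : ∀ t ∈ Set.Ioi (0 : ℝ), ‖Complex.exp (-((ω : ℂ) * t)) • T t x‖ ^ 2 ≤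
      (M₀ * ‖x‖) ^ 2 * Real.exp (-2 * t) := by
    intro t ht
    have ht0 : 0 ≤ t := le_of_lt ht
    have h1 : ‖Complex.exp (-((ω : ℂ) * t)) • T t x‖ ≤ M₀ * ‖x‖ * Real.exp (-t) := by
      rw [norm_smul, norm_exp_neg_mul_ofReal, Complex.ofReal_re]
      have hK : 0 ≤ M₀ * ‖x‖ := by
        have := (norm_nonneg _).trans (hbd 0 le_rfl)
        simpa using this
      calc Real.exp (-(ω * t)) * ‖T t x‖
          ≤ Real.exp (-(ω * t)) * (M₀ * ‖x‖ * Real.exp (ω₀ * t)) := by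
            gcongr
            exact hbd t ht0
        _ = M₀ * ‖x‖ * Real.exp (-((ω - ω₀) * t)) := by
            rw [mul_left_comm, ← Real.exp_add]
            ring_nf
        _ ≤ M₀ * ‖x‖ * Real.exp (-t) := by
            gcongr
            nlinarith
    calc _ ≤ (M₀ * ‖x‖ * Real.exp (-t)) ^ 2 := by gcongr
      _ = (M₀ * ‖x‖) ^ 2 * Real.exp (-2 * t) := by
        rw [mul_pow, ← Real.exp_nat_mul]
        push_cast
        ring_nf
  have hdom : IntegrableOn (fun t : ℝ => (M₀ * ‖x‖) ^ 2 * Real.exp (-2 * t)) (Set.Ioi 0) :=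
    (exp_neg_integrableOn_Ioi 0 two_pos).const_mul _
  have hu_sq : IntegrableOn (fun t : ℝ => ‖Complex.exp (-((ω : ℂ) * t)) • T t x‖ ^ 2)
      (Set.Ioi 0) := by
    refine Integrable.mono' hdom (hu_int.1.norm.pow 2) ?_
    filter_upwards [ae_restrict_mem measurableSet_Ioi] with t ht
    rw [Real.norm_of_nonneg (sq_nonneg _)]
    exact hsq t ht
  have hR : ∀ ξ : ℝ, R (ω + (2 * Real.pi * ξ : ℝ) * Complex.I) x =
      ∫ t in Set.Ioi (0:ℝ), Complex.exp (-((ω + (2 * Real.pi * ξ : ℝ) * Complex.I) * t)) • T t x :=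
    fun ξ => hlap _ (by
      simp only [Complex.add_re, Complex.ofReal_re, Complex.re_ofReal_mul, Complex.I_re, mul_zero]
      linarith) x
  obtain ⟨hi, he⟩ := integral_norm_laplace_sq measurableSet_Ioi hu_int hu_sq
  simp only [hR]
  refine ⟨hi, he.trans_le ((setIntegral_mono_on hu_sq hdom measurableSet_Ioi hsq).trans ?_)⟩
  rw [integral_const_mul, integral_exp_mul_Ioi (by norm_num), mul_pow]
  simp only [mul_zero, Real.exp_zero]
  nlinarith [mul_nonneg (sq_nonneg M₀) (sq_nonneg ‖x‖)]

theorem norm_resolvent_apply_le_mul {X : Type*} [NormedAddCommGroup X] [NormedSpace ℂ X]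
    {R : ℂ → (X →L[ℂ] X)} {l μ : ℂ} (hres : R l - R μ = (μ - l) • ((R l).comp (R μ)))
    {r G : ℝ} (hr : ‖μ - l‖ ≤ r) (hG : ‖R l‖ ≤ G) (y : X) :
    ‖R l y‖ ≤ (1 + r * G) * ‖R μ y‖ := by
  have h : R l y = R μ y + (μ - l) • R l (R μ y) := by
    have := congrArg (fun S : X →L[ℂ] X => S y) hres
    simp only [sub_apply, smul_apply,
      ContinuousLinearMap.comp_apply] at this
    rw [← this]
    abel
  have hr0 : 0 ≤ r := (norm_nonneg _).trans hr
  calc ‖R l y‖ ≤ ‖R μ y‖ + ‖(μ - l) • R l (R μ y)‖ := h ▸ norm_add_le _ _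
    _ ≤ ‖R μ y‖ + r * (G * ‖R μ y‖) := by
        rw [norm_smul]
        gcongr
        exact (R l).le_of_opNorm_le hG _
    _ = (1 + r * G) * ‖R μ y‖ := by ring

theorem integral_norm_exp_smul_semigroup_sq_le
    {X : Type*} [NormedAddCommGroup X] [InnerProductSpace ℂ X] [CompleteSpace X]
    {T : ℝ → (X →L[ℂ] X)} {M₀ ω₀ : ℝ}
    (hTsemi : ∀ s t : ℝ, 0 ≤ s → 0 ≤ t → T (s + t) = (T s).comp (T t))
    (hTcont : ∀ x : X, ContinuousOn (fun t => T t x) (Set.Ici 0))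
    (hTbdd : ∀ t : ℝ, 0 ≤ t → ‖T t‖ ≤ M₀ * Real.exp (ω₀ * t))
    {R : ℂ → (X →L[ℂ] X)} (hR : DifferentiableOn ℂ R {l | 0 < l.re})
    (hres : ∀ l μ : ℂ, 0 < l.re → 0 < μ.re →
      R l - R μ = (μ - l) • ((R l).comp (R μ)))
    (hlap : ∀ l : ℂ, max ω₀ 0 < l.re → ∀ x : X,
      R l x = ∫ t in Set.Ioi (0:ℝ), Complex.exp (-(l * t)) • T t x)
    {ω : ℝ} (hω : max ω₀ 0 + 1 ≤ ω) {a G : ℝ} (ha : 0 < a) (haω : a ≤ ω)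
    (hG : ∀ l : ℂ, l.re = a → ‖R l‖ ≤ G) (x : X) {τ : ℝ} (hτ : 0 ≤ τ) :
    ∫ t in (0:ℝ)..τ, ‖Complex.exp (-((a : ℂ) * t)) • T t x‖ ^ 2 ≤
      2 * ((1 + ω * G) * M₀) ^ 2 * (‖x‖ ^ 2 + ‖Complex.exp (-((a : ℂ) * τ)) • T τ x‖ ^ 2) := by
  set z : X := Complex.exp (-((a : ℂ) * τ)) • T τ x with hz
  have hc : ContinuousOn (fun t : ℝ => Complex.exp (-((a : ℂ) * t)) • T t x) (Set.Icc 0 τ) :=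
    (by fun_prop : Continuous fun t : ℝ => Complex.exp (-((a : ℂ) * t))).continuousOn.smul
      ((hTcont x).mono Set.Icc_subset_Ici_self)
  obtain ⟨hi, he⟩ := integral_norm_laplace_sq measurableSet_Ioc
    (hc.integrableOn_Icc.mono_set Set.Ioc_subset_Icc_self)
    ((hc.norm.pow 2).integrableOn_Icc.mono_set Set.Ioc_subset_Icc_self)
  obtain ⟨hx, hx'⟩ := integral_norm_resolvent_sq_le hTcont hTbdd hlap hω x
  obtain ⟨hy, hy'⟩ := integral_norm_resolvent_sq_le hTcont hTbdd hlap hω z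
  have hω0 : 0 < ω := ha.trans_le haω
  have hpt : ∀ ξ : ℝ,
      ‖∫ t in Set.Ioc 0 τ, Complex.exp (-((a + (2 * Real.pi * ξ : ℝ) * Complex.I) * t)) • T t x‖ ^ 2
      ≤ 2 * (1 + ω * G) ^ 2 * (‖R (ω + (2 * Real.pi * ξ : ℝ) * Complex.I) x‖ ^ 2 +
        ‖R (ω + (2 * Real.pi * ξ : ℝ) * Complex.I) z‖ ^ 2) := by
    intro ξ
    set l : ℂ := a + (2 * Real.pi * ξ : ℝ) * Complex.I with hl
    set μ : ℂ := ω + (2 * Real.pi * ξ : ℝ) * Complex.I with hμ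
    have hlre : l.re = a := by simp [hl]
    have hμre : μ.re = ω := by simp [hμ]
    have hdiff : ‖μ - l‖ ≤ ω := by
      have : μ - l = ((ω - a : ℝ) : ℂ) := by
        rw [hμ, hl]
        push_cast
        ring
      rw [this, Complex.norm_real, Real.norm_of_nonneg (by linarith)]
      linarith
    have hle := norm_resolvent_apply_le_mul (hres l μ (hlre ▸ ha) (hμre ▸ hω0)) hdiff (hG l hlre)
    have hexp : Complex.exp (-(l * τ)) • T τ x =
        Complex.exp (-(((2 * Real.pi * ξ : ℝ) * Complex.I) * τ)) • z := by
      rw [hz, smul_smul, ← Complex.exp_add, hl]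
      ring_nf
    have hunit : ‖Complex.exp (-(((2 * Real.pi * ξ : ℝ) * Complex.I) * τ))‖ = 1 := by
      rw [norm_exp_neg_mul_ofReal]
      simp
    rw [← intervalIntegral.integral_of_le hτ,
      integral_exp_smul_semigroup_eq_resolvent hTsemi hTcont hTbdd hR hlap hτ x (hlre ▸ ha),
      hexp, map_sub, map_smul]
    have h1 : ‖R l x - Complex.exp (-(((2 * Real.pi * ξ : ℝ) * Complex.I) * τ)) • R l z‖ ≤
        (1 + ω * G) * (‖R μ x‖ + ‖R μ z‖) := by
      refine (norm_sub_le _ _).trans ?_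
      rw [norm_smul, hunit, one_mul, mul_add]
      exact add_le_add (hle x) (hle z)
    calc _ ≤ ((1 + ω * G) * (‖R μ x‖ + ‖R μ z‖)) ^ 2 := by gcongr
      _ ≤ _ := by
        nlinarith [mul_nonneg (sq_nonneg (1 + ω * G)) (sq_nonneg (‖R μ x‖ - ‖R μ z‖))]
  rw [intervalIntegral.integral_of_le hτ, ← he]
  refine (integral_mono hi ((hx.add hy).const_mul _) hpt).trans ?_
  simp only [Pi.add_apply]
  rw [integral_const_mul, integral_add hx hy]
  calc _ ≤ 2 * (1 + ω * G) ^ 2 * (M₀ ^ 2 * ‖x‖ ^ 2 + M₀ ^ 2 * ‖z‖ ^ 2) := by gcongr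
    _ = _ := by ring

theorem integral_le_of_integral_le_of_exp_bound {n : ℝ → ℝ} (hn : ContinuousOn n (Set.Ici 0))
    {c m M κ : ℝ} (hc : 0 < c) (hκ : κ * c < 1)
    (hM : ∀ t : ℝ, 0 ≤ t → n t ≤ M * Real.exp (κ * t))
    (h : ∀ t : ℝ, 0 ≤ t → ∫ s in (0:ℝ)..t, n s ≤ c * (m + n t)) {t₀ : ℝ} (ht₀ : 0 ≤ t₀) :
    ∫ s in (0:ℝ)..t₀, n s ≤ c * m := by
  by_contra! hlt
  set φ : ℝ → ℝ := fun t => (∫ s in (0:ℝ)..t, n s) - c * m with hφ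
  have hφc : ContinuousOn φ (Set.Ici 0) := by
    intro t ht
    have hI : IntegrableOn n (Set.uIcc 0 (t + 1)) := by
      rw [Set.uIcc_of_le (by linarith [Set.mem_Ici.1 ht])]
      exact (hn.mono Set.Icc_subset_Ici_self).integrableOn_Icc
    have h1 := (intervalIntegral.continuousOn_primitive_interval hI).sub
      (continuousOn_const (c := c * m))
    rw [Set.uIcc_of_le (by linarith [Set.mem_Ici.1 ht])] at h1
    refine (h1 t ⟨ht, by linarith⟩).mono_of_mem_nhdsWithin ?_
    filter_upwards [self_mem_nhdsWithin, nhdsWithin_le_nhds (Iio_mem_nhds (lt_add_one t))]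
      with s hs hs' using ⟨hs, le_of_lt hs'⟩
  have hφd : ∀ t : ℝ, 0 < t → HasDerivAt φ (n t) t := by
    intro t ht
    refine (intervalIntegral.integral_hasDerivAt_right
      ((hn.mono Set.Icc_subset_Ici_self).intervalIntegrable_of_Icc ht.le) ?_
      (hn.continuousAt (Ici_mem_nhds ht))).sub_const _
    exact (hn.mono Set.Ioi_subset_Ici_self).stronglyMeasurableAtFilter isOpen_Ioi t ht
  have hmono : MonotoneOn (fun t => Real.exp (-t / c) * φ t) (Set.Ici 0) := by
    refine monotoneOn_of_hasDerivWithinAt_nonneg (convex_Ici 0)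
      (f' := fun t => Real.exp (-t / c) * (-1 / c) * φ t + Real.exp (-t / c) * n t)
      ((by fun_prop : Continuous fun t : ℝ => Real.exp (-t / c)).continuousOn.mul hφc) ?_ ?_
    · intro t ht
      rw [interior_Ici] at ht
      exact ((((hasDerivAt_id t).neg.div_const c).exp).mul (hφd t ht)).hasDerivWithinAt
    · intro t ht
      rw [interior_Ici] at ht
      have h1 := h t (le_of_lt ht)
      have h2 : φ t / c ≤ n t := by
        rw [div_le_iff₀ hc]
        simp only [hφ]
        linarith
      have : Real.exp (-t / c) * (-1 / c) * φ t + Real.exp (-t / c) * n t =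
          Real.exp (-t / c) * (n t - φ t / c) := by ring
      rw [this]
      exact mul_nonneg (Real.exp_pos _).le (sub_nonneg.2 h2)
  set k : ℝ := Real.exp (-t₀ / c) * φ t₀ with hk
  have hkpos : 0 < k := mul_pos (Real.exp_pos _) (sub_pos.2 hlt)
  have hrate : 0 < 1 / c - κ := by
    rw [sub_pos, lt_div_iff₀ hc]
    exact hκ
  have hbound : ∀ t : ℝ, t₀ ≤ t → Real.exp ((1 / c - κ) * t) ≤ c * M / k := by
    intro t ht
    have ht0 := ht₀.trans ht
    have h1 : k ≤ Real.exp (-t / c) * φ t := hmono ht₀ ht0 ht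
    have h2 : φ t ≤ c * (M * Real.exp (κ * t)) := by
      have := h t ht0
      have := mul_le_mul_of_nonneg_left (hM t ht0) hc.le
      simp only [hφ]
      linarith
    rw [le_div_iff₀ hkpos]
    calc Real.exp ((1 / c - κ) * t) * k
        ≤ Real.exp ((1 / c - κ) * t) * (Real.exp (-t / c) * (c * (M * Real.exp (κ * t)))) := by
          gcongr
          exact h1.trans (by gcongr)
      _ = c * M * (Real.exp ((1 / c - κ) * t) * Real.exp (-t / c) * Real.exp (κ * t)) := by ring
      _ = c * M := by
          rw [← Real.exp_add, ← Real.exp_add,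
            show (1 / c - κ) * t + -t / c + κ * t = 0 by ring, Real.exp_zero, mul_one]
  have htop : Filter.Tendsto (fun t : ℝ => Real.exp ((1 / c - κ) * t)) Filter.atTop Filter.atTop :=
    Real.tendsto_exp_atTop.comp (Filter.tendsto_id.const_mul_atTop hrate)
  obtain ⟨t, ht, ht'⟩ := ((htop.eventually_gt_atTop (c * M / k)).and
    (Filter.eventually_ge_atTop t₀)).exists
  exact absurd (hbound t ht') (not_le.2 ht)

theorem norm_exp_smul_semigroup_le_of_integral_le
    {X : Type*} [NormedAddCommGroup X] [NormedSpace ℂ X]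
    {T : ℝ → (X →L[ℂ] X)}
    (hTsemi : ∀ s t : ℝ, 0 ≤ s → 0 ≤ t → T (s + t) = (T s).comp (T t))
    (hTcont : ∀ x : X, ContinuousOn (fun t => T t x) (Set.Ici 0))
    {L : ℝ} (hL : ∀ t : ℝ, 0 ≤ t → t ≤ 1 → ‖T t‖ ≤ L)
    {a D : ℝ} (ha : 0 ≤ a) (hD : 0 ≤ D) (x : X) {t : ℝ} (ht : 1 ≤ t)
    (hu_int : ∫ s in (0:ℝ)..t, ‖Complex.exp (-((a : ℂ) * s)) • T s x‖ ^ 2 ≤ (D * ‖x‖) ^ 2) :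
    ‖Complex.exp (-((a : ℂ) * t)) • T t x‖ ≤ L * (D * ‖x‖) := by
  have hL0 : 0 ≤ L := (norm_nonneg _).trans (hL 0 le_rfl zero_le_one)
  set n : ℝ → ℝ := fun s => ‖Complex.exp (-((a : ℂ) * s)) • T s x‖ with hn
  have hnc : ContinuousOn n (Set.Ici 0) :=
    ((by fun_prop : Continuous fun s : ℝ => Complex.exp (-((a : ℂ) * s))).continuousOn.smul
      (hTcont x)).norm
  have hle : ∀ s ∈ Set.Icc (t - 1) t, n t ^ 2 ≤ L ^ 2 * n s ^ 2 := by
    intro s hs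
    have hs0 : 0 ≤ s := by linarith [hs.1]
    rw [← mul_pow]
    refine pow_le_pow_left₀ (norm_nonneg _) ?_ 2
    simp only [hn, norm_smul, norm_exp_neg_mul_ofReal, Complex.ofReal_re]
    have hT : ‖T t x‖ ≤ L * ‖T s x‖ := by
      have := hTsemi (t - s) s (by linarith [hs.2]) hs0
      rw [sub_add_cancel] at this
      rw [this]
      exact (T (t - s)).le_of_opNorm_le (hL _ (by linarith [hs.2]) (by linarith [hs.1])) _
    calc Real.exp (-(a * t)) * ‖T t x‖ ≤ Real.exp (-(a * s)) * (L * ‖T s x‖) := by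
          gcongr
          exact hs.2
      _ = L * (Real.exp (-(a * s)) * ‖T s x‖) := by ring
  have hi : ∀ p q : ℝ, 0 ≤ p → p ≤ q → IntervalIntegrable (fun s => n s ^ 2) volume p q :=
    fun p q hp hpq => ((hnc.pow 2).mono fun s hs => hp.trans hs.1).intervalIntegrable_of_Icc hpq
  have h1 : n t ^ 2 ≤ L ^ 2 * ∫ s in (t - 1)..t, n s ^ 2 := by
    have := intervalIntegral.integral_mono_on (by linarith : t - 1 ≤ t)
      (intervalIntegrable_const (c := n t ^ 2) (μ := volume))
      ((hi (t - 1) t (by linarith) (by linarith)).const_mul (L ^ 2)) hle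
    simpa using this
  have h2 : ∫ s in (t - 1)..t, n s ^ 2 ≤ ∫ s in (0:ℝ)..t, n s ^ 2 := by
    rw [← intervalIntegral.integral_add_adjacent_intervals (hi 0 (t - 1) le_rfl (by linarith))
      (hi (t - 1) t (by linarith) (by linarith))]
    exact le_add_of_nonneg_left
      (intervalIntegral.integral_nonneg (by linarith) fun s _ => sq_nonneg _)
  refine le_of_sq_le_sq ?_ (by positivity)
  calc n t ^ 2 ≤ L ^ 2 * (D * ‖x‖) ^ 2 := h1.trans (by gcongr; exact h2.trans hu_int)
    _ = (L * (D * ‖x‖)) ^ 2 := by ring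

/-- If the resolvent is bounded by `G` on `a₀ ≤ Re l ≤ ω`, the semigroup has growth rate at most
`a₀`, with a constant that is affine in `G`. -/
theorem norm_semigroup_le_of_norm_resolvent_le
    {X : Type*} [NormedAddCommGroup X] [InnerProductSpace ℂ X] [CompleteSpace X]
    {T : ℝ → (X →L[ℂ] X)} {M₀ ω₀ : ℝ} (hM₀ : 1 ≤ M₀)
    (hTsemi : ∀ s t : ℝ, 0 ≤ s → 0 ≤ t → T (s + t) = (T s).comp (T t))
    (hTcont : ∀ x : X, ContinuousOn (fun t => T t x) (Set.Ici 0))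
    (hTbdd : ∀ t : ℝ, 0 ≤ t → ‖T t‖ ≤ M₀ * Real.exp (ω₀ * t))
    {R : ℂ → (X →L[ℂ] X)} (hR : DifferentiableOn ℂ R {l | 0 < l.re})
    (hres : ∀ l μ : ℂ, 0 < l.re → 0 < μ.re →
      R l - R μ = (μ - l) • ((R l).comp (R μ)))
    (hlap : ∀ l : ℂ, max ω₀ 0 < l.re → ∀ x : X,
      R l x = ∫ t in Set.Ioi (0:ℝ), Complex.exp (-(l * t)) • T t x)
    {ω : ℝ} (hω : max ω₀ 0 + 1 ≤ ω) {a₀ G : ℝ} (ha₀ : 0 < a₀) (haω : a₀ ≤ ω) (hG0 : 0 ≤ G)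
    (hG : ∀ l : ℂ, a₀ ≤ l.re → l.re ≤ ω → ‖R l‖ ≤ G) {t : ℝ} (ht : 1 ≤ t) :
    ‖T t‖ ≤ M₀ * Real.exp |ω₀| * (2 * ((1 + ω * G) * M₀)) * Real.exp (a₀ * t) := by
  have hω1 : 1 ≤ ω := by linarith [le_max_right ω₀ 0]
  set L : ℝ := M₀ * Real.exp |ω₀| with hLdef
  have hL : ∀ t : ℝ, 0 ≤ t → t ≤ 1 → ‖T t‖ ≤ L := by
    intro t h0 h1
    refine (hTbdd t h0).trans ?_
    have : ω₀ * t ≤ |ω₀| :=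
      (mul_le_mul_of_nonneg_right (le_abs_self ω₀) h0).trans
        (mul_le_of_le_one_right (abs_nonneg _) h1)
    rw [hLdef]
    gcongr
  set D : ℝ := 2 * ((1 + ω * G) * M₀) with hDdef
  set c : ℝ := 2 * ((1 + ω * G) * M₀) ^ 2 with hcdef
  have hbase : 0 < (1 + ω * G) * M₀ := by positivity
  have hcpos : 0 < c := by positivity
  have hL0 : 0 ≤ L := by positivity
  have hstep : ∀ a b M : ℝ, a₀ ≤ a → a ≤ ω → a ≤ b → b ≤ a + 1 / (4 * c) →
      (∀ t : ℝ, 0 ≤ t → ‖T t‖ ≤ M * Real.exp (b * t)) →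
      ∀ t : ℝ, 1 ≤ t → ‖T t‖ ≤ L * D * Real.exp (a * t) := by
    intro a b M haa haω' _ hba hM t ht
    have ha : 0 < a := ha₀.trans_le haa
    refine (T t).opNorm_le_bound (by positivity) fun x => ?_
    have hn : ∀ s : ℝ, ‖Complex.exp (-((a : ℂ) * s)) • T s x‖ = Real.exp (-(a * s)) * ‖T s x‖ :=
      fun s => by rw [norm_smul, norm_exp_neg_mul_ofReal, Complex.ofReal_re]
    have hu_int := integral_le_of_integral_le_of_exp_bound
      (n := fun s : ℝ => ‖Complex.exp (-((a : ℂ) * s)) • T s x‖ ^ 2)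
      (c := c) (m := ‖x‖ ^ 2) (M := (M * ‖x‖) ^ 2) (κ := 2 * (b - a))
      (((by fun_prop : Continuous fun s : ℝ => Complex.exp (-((a : ℂ) * s))).continuousOn.smul
        (hTcont x)).norm.pow 2) hcpos ?_ ?_
      (fun s hs => integral_norm_exp_smul_semigroup_sq_le hTsemi hTcont hTbdd hR hres hlap hω ha
        haω' (fun l hl => hG l (hl ▸ haa) (hl ▸ haω')) x hs) (zero_le_one.trans ht)
    · have hle : c * ‖x‖ ^ 2 ≤ (D * ‖x‖) ^ 2 := by
        rw [mul_pow]
        gcongr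
        rw [hcdef, hDdef]
        nlinarith [sq_nonneg ((1 + ω * G) * M₀)]
      have := norm_exp_smul_semigroup_le_of_integral_le hTsemi hTcont hL ha.le
        (by positivity : 0 ≤ D) x ht (hu_int.trans hle)
      rw [hn, Real.exp_neg, inv_mul_le_iff₀ (Real.exp_pos _)] at this
      exact this.trans_eq (by ring)
    · have := mul_le_mul_of_nonneg_right hba hcpos.le
      rw [add_mul, show 1 / (4 * c) * c = 1 / 4 by field_simp] at this
      nlinarith
    · intro s hs
      calc ‖Complex.exp (-((a : ℂ) * s)) • T s x‖ ^ 2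
          ≤ (Real.exp (-(a * s)) * (M * Real.exp (b * s) * ‖x‖)) ^ 2 := by
            rw [hn]
            gcongr
            exact (T s).le_of_opNorm_le (hM s hs) x
        _ = (M * ‖x‖) ^ 2 * (Real.exp (-(a * s)) * Real.exp (b * s)) ^ 2 := by ring
        _ = (M * ‖x‖) ^ 2 * Real.exp (2 * (b - a) * s) := by
            rw [← Real.exp_add, ← Real.exp_nat_mul]
            push_cast
            ring_nf
  have hall : ∀ k : ℕ, ∃ M : ℝ, ∀ t : ℝ, 0 ≤ t →
      ‖T t‖ ≤ M * Real.exp (max a₀ (ω - k * (1 / (4 * c))) * t) := by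
    intro k
    induction k with
    | zero =>
      refine ⟨M₀, fun t ht => (hTbdd t ht).trans ?_⟩
      gcongr
      refine le_max_of_le_right ?_
      simp only [Nat.cast_zero, zero_mul, sub_zero]
      linarith [le_max_left ω₀ 0]
    | succ k ih =>
      obtain ⟨M, hM⟩ := ih
      have hδ : 0 < 1 / (4 * c) := by positivity
      have h1 := hstep (max a₀ (ω - (k + 1 : ℕ) * (1 / (4 * c)))) _ M (le_max_left _ _)
        (max_le haω (sub_le_self _ (by positivity)))
        (max_le_max le_rfl (by push_cast; linarith))
        (max_le ((le_max_left _ _).trans (le_add_of_nonneg_right hδ.le))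
          (by
            refine le_trans ?_ (add_le_add_left (le_max_right _ _) _)
            push_cast
            linarith)) hM
      refine ⟨max L (L * D), fun t ht => ?_⟩
      rcases le_total 1 t with h | h
      · exact (h1 t h).trans (by gcongr; exact le_max_right _ _)
      · refine ((hL t ht h).trans (le_max_left _ (L * D))).trans
          (le_mul_of_one_le_right (hL0.trans (le_max_left _ _)) (Real.one_le_exp ?_))
        exact mul_nonneg (ha₀.le.trans (le_max_left _ _)) ht
  obtain ⟨k, hk⟩ := exists_nat_ge (ω / (1 / (4 * c)))
  rw [div_le_iff₀ (by positivity)] at hk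
  obtain ⟨M, hM⟩ := hall k
  rw [max_eq_left (by linarith)] at hM
  exact hstep a₀ a₀ M le_rfl haω le_rfl (le_add_of_nonneg_right (by positivity)) hM t ht

/-- Hilbert-space refined growth under a generalized Kreiss condition: if
`‖R(λ)‖ ≤ g(1/Re λ)` on the open right half-plane for a non-decreasing `g`, then
`‖T(t)‖ ≤ C g(t)` for all `t ≥ 1`. In particular the Kreiss condition implies at most linear
growth of a semigroup on a Hilbert space. -/
theorem hilbert_kreiss_growth
    {X : Type*} [NormedAddCommGroup X] [InnerProductSpace ℂ X] [CompleteSpace X]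
    (T : ℝ → (X →L[ℂ] X)) (M₀ ω₀ : ℝ) (hM₀ : 1 ≤ M₀)
    (hT0 : T 0 = 1)
    (hTsemi : ∀ s t : ℝ, 0 ≤ s → 0 ≤ t → T (s + t) = (T s).comp (T t))
    (hTcont : ∀ x : X, ContinuousOn (fun t => T t x) (Set.Ici 0))
    (hTbdd : ∀ t : ℝ, 0 ≤ t → ‖T t‖ ≤ M₀ * Real.exp (ω₀ * t))
    (R : ℂ → (X →L[ℂ] X))
    (hres : ∀ l μ : ℂ, 0 < l.re → 0 < μ.re →
      R l - R μ = (μ - l) • ((R l).comp (R μ)))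
    (hlap : ∀ l : ℂ, max ω₀ 0 < l.re → ∀ x : X,
      R l x = ∫ t in Set.Ioi (0:ℝ), Complex.exp (-(l * t)) • T t x)
    (g : ℝ → ℝ) (hgpos : ∀ s : ℝ, 0 < s → 0 < g s)
    (hgmono : ∀ s t : ℝ, 0 < s → s ≤ t → g s ≤ g t)
    (hbdd : ∀ l : ℂ, 0 < l.re → ‖R l‖ ≤ g (1 / l.re)) :
    ∃ C : ℝ, 0 ≤ C ∧ ∀ t : ℝ, 1 ≤ t → ‖T t‖ ≤ C * g t := by
  have hopen : IsOpen {l : ℂ | 0 < l.re} := isOpen_lt continuous_const Complex.continuous_re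
  have hR : DifferentiableOn ℂ R {l | 0 < l.re} := by
    refine differentiableOn_of_resolvent_identity hopen
      (fun l hl μ hμ => hres l μ hl hμ) fun μ hμ => ⟨g (2 / μ.re), ?_⟩
    have hμ' : 0 < μ.re := hμ
    filter_upwards [(isOpen_lt continuous_const Complex.continuous_re).mem_nhds
      (show μ.re / 2 < μ.re by linarith)] with l hl
    have hl' : μ.re / 2 < l.re := hl
    have hl0 : 0 < l.re := by linarith
    refine (hbdd l hl0).trans (hgmono _ _ (by positivity) ?_)
    rw [div_le_div_iff₀ hl0 hμ']
    linarith
  set ω : ℝ := max ω₀ 0 + 1 with hω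
  have hω1 : 1 ≤ ω := by linarith [le_max_right ω₀ 0]
  have hg1 := hgpos 1 one_pos
  refine ⟨M₀ * Real.exp |ω₀| * (2 * ((1 / g 1 + ω) * M₀)) * Real.exp 1, by positivity,
    fun t ht => ?_⟩
  have ht0 : 0 < t := by linarith
  have hgt := hgmono 1 t one_pos ht
  have key := norm_semigroup_le_of_norm_resolvent_le hM₀ hTsemi hTcont hTbdd hR hres hlap hω.ge
    (a₀ := 1 / t) (G := g t) (by positivity) (((div_le_one ht0).2 ht).trans hω1) (hgpos t ht0).le
    (fun l hl _ => by
      have hl0 : 0 < l.re := (by positivity : 0 < 1 / t).trans_le hl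
      exact (hbdd l hl0).trans (hgmono _ _ (by positivity) ((one_div_le ht0 hl0).1 hl))) ht
  rw [one_div_mul_cancel ht0.ne'] at key
  have hone : 1 + ω * g t ≤ (1 / g 1 + ω) * g t := by
    have : 1 ≤ 1 / g 1 * g t := by rwa [one_div_mul_eq_div, one_le_div hg1]
    linarith
  calc ‖T t‖ ≤ M₀ * Real.exp |ω₀| * (2 * ((1 + ω * g t) * M₀)) * Real.exp 1 := key
    _ ≤ M₀ * Real.exp |ω₀| * (2 * ((1 / g 1 + ω) * g t * M₀)) * Real.exp 1 := by gcongr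
    _ = _ := by ring
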